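/- Let x₁,…,x_{2n+1} ∈ ℂ^{n+1} be in general position (any n+1 of them linearly independent), with associated linear forms L_i(v) = Σ_{j=0}^n x_{ij} v_j. Let (A_I)_{I∈𝓘} be complex constants, not all zero, indexed by the n-element subsets of {1,…,2n+1}. Then the polynomial in 2n+2 variables Q(v₀,…,vₙ,w₀,…,wₙ) = Σ_{I∈𝓘} A_I (∏_{i∈I} L_i(v)) (∏_{i∈I^c} L_i(w)) is not the zero polynomial. (The key algebraic content of the proof of Proposition 2.2, via Proposition 2.1.) -/

import Mathlib

noncomputable section

/-- The vectors `x 0, …, x (q-1)` in `ℂ^{n+1}` are in general position: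
any `n + 1` of them are linearly independent. -/
def GenPos (n q : ℕ) (x : Fin q → Fin (n + 1) → ℂ) : Prop :=
  ∀ s : Finset (Fin q), s.card = n + 1 → LinearIndependent ℂ (fun i : s => x i.1)

/-- For vectors in general position and a set `J` of `n` indices, some point of `ℂ^{n+1}` lies on
exactly those hyperplanes whose index is in `J`. -/
theorem GenPos.exists_dotProduct_eq_zero_iff {n q : ℕ} {x : Fin q → Fin (n + 1) → ℂ}
    (hx : GenPos n q x) {J : Finset (Fin q)} (hJ : J.card = n) :
    ∃ w : Fin (n + 1) → ℂ, ∀ i, x i ⬝ᵥ w = 0 ↔ i ∈ J := by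
  obtain ⟨w, hw, hw0⟩ := Submodule.exists_mem_ne_zero_of_ne_bot
    (LinearMap.ker_ne_bot_of_finrank_lt
      (f := Matrix.mulVecLin (Matrix.of fun i : J => x i)) (by simp [hJ]))
  have hwJ : ∀ i ∈ J, x i ⬝ᵥ w = 0 := fun i hi => congrFun (LinearMap.mem_ker.mp hw) ⟨i, hi⟩
  refine ⟨w, fun i => ⟨fun hi => ?_, hwJ i⟩⟩
  by_contra hiJ
  have hcard : (insert i J).card = n + 1 := by rw [Finset.card_insert_of_notMem hiJ, hJ]
  have hspan := (hx _ hcard).span_eq_top_of_card_eq_finrank' (by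
    rw [Fintype.card_coe, hcard, Module.finrank_fin_fun])
  apply hw0
  refine dotProduct_eq_zero w fun y => ?_
  have hy : y ∈ Submodule.span ℂ (Set.range fun k : ↥(insert i J) => x k) := hspan ▸ trivial
  rw [dotProduct_comm]
  induction hy using Submodule.span_induction with
  | mem y hy =>
    obtain ⟨⟨k, hk⟩, rfl⟩ := hy
    rcases Finset.mem_insert.mp hk with rfl | hk
    exacts [hi, hwJ k hk]
  | zero => simp
  | add y z _ _ hy hz => rw [add_dotProduct, hy, hz, add_zero]
  | smul c y _ hy => rw [smul_dotProduct, hy, smul_zero]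

/-- **Key algebraic content of Proposition 2.2.** For vectors
`x₁, …, x_{2n+1} ∈ ℂ^{n+1}` in general position with linear forms
`L_i(v) = Σ_j x_{ij} v_j`, and constants `A_I`, not all zero, indexed by the
`n`-element subsets `I` of `{1, …, 2n+1}`, the polynomial
`Q(v, w) = Σ_I A_I (∏_{i∈I} L_i(v)) (∏_{i∈Iᶜ} L_i(w))` is nonzero. -/
theorem key_polynomial_nonzero
    (n : ℕ)
    (x : Fin (2 * n + 1) → Fin (n + 1) → ℂ)
    (hGP : GenPos n (2 * n + 1) x)
    (A : Finset (Fin (2 * n + 1)) → ℂ)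
    (hA : ∃ I ∈ Finset.powersetCard n (Finset.univ : Finset (Fin (2 * n + 1))), A I ≠ 0) :
    (∑ I ∈ Finset.powersetCard n (Finset.univ : Finset (Fin (2 * n + 1))),
        MvPolynomial.C (A I) *
          ((∏ i ∈ I, ∑ j, MvPolynomial.C (x i j) *
              (MvPolynomial.X (Sum.inl j) : MvPolynomial (Fin (n + 1) ⊕ Fin (n + 1)) ℂ)) *
            ∏ i ∈ Iᶜ, ∑ j, MvPolynomial.C (x i j) * MvPolynomial.X (Sum.inr j))) ≠ 0 := by
  obtain ⟨J, hJ, hAJ⟩ := hA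
  have hJn := (Finset.mem_powersetCard.mp hJ).2
  obtain ⟨K, hKJ, hK⟩ := Finset.exists_subset_card_eq (s := Jᶜ) (n := n) (by
    rw [Finset.card_compl, hJn, Fintype.card_fin]; omega)
  obtain ⟨w, hw⟩ := hGP.exists_dotProduct_eq_zero_iff hJn
  obtain ⟨v, hv⟩ := hGP.exists_dotProduct_eq_zero_iff hK
  intro hQ
  have hQ' := congrArg (MvPolynomial.eval (Sum.elim v w)) hQ
  simp only [map_sum, map_mul, map_prod, MvPolynomial.eval_C, MvPolynomial.eval_X, Sum.elim_inl,
    Sum.elim_inr, map_zero] at hQ'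
  rw [Finset.sum_eq_single_of_mem J hJ] at hQ'
  · refine mul_ne_zero hAJ (mul_ne_zero ?_ ?_) hQ'
    · refine Finset.prod_ne_zero_iff.mpr fun i hi h => ?_
      exact Finset.mem_compl.mp (hKJ ((hv i).mp h)) hi
    · exact Finset.prod_ne_zero_iff.mpr fun i hi h => Finset.mem_compl.mp hi ((hw i).mp h)
  · intro I hI hIJ
    have hnot : ¬J ⊆ I := fun h => hIJ
      (Finset.eq_of_subset_of_card_le h (by rw [hJn, (Finset.mem_powersetCard.mp hI).2])).symm
    obtain ⟨i, hiJ, hiI⟩ := Finset.not_subset.mp hnot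
    rw [Finset.prod_eq_zero (Finset.mem_compl.mpr hiI) ((hw i).mpr hiJ), mul_zero, mul_zero]
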